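/- Fix m ≥ 1 and j with 2 ≤ j ≤ m, and consider the complete bipartite permutation τ_{m,2} ∈ S_{m+2}. The 1-subgraph S₂ of its inversion graph consisting of exactly the two (crossing) edges (1, m+2) and (j, m+1) is valid if and only if m + j is odd. -/

import Mathlib

/- Common definitions: the classical and MVP parking processes, parking
functions, inversion graphs and 1-subgraphs, Motzkin paths, and sandpile
configurations on complete graphs. Spots, cars and vertices are 0-indexed
(element `i : Fin n` corresponds to the 1-indexed `i+1` of the paper). -/

namespace MVPPaper

open Finset

variable {n : ℕ}

/-- The first unoccupied spot `k ≥ s` in the occupancy `occ`, if any exists.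
`occ k = some i` means spot `k` is occupied by car `i`. -/
def firstFree (occ : Fin n → Option (Fin n)) (s : Fin n) : Option (Fin n) :=
  (List.finRange n).find? fun k => decide (s ≤ k) && (occ k).isNone

/-- One step of the classical parking process: car `i`, preferring spot `s`,
parks in the first free spot `k ≥ s` (failure if none exists). -/
def classicalStep (occ : Fin n → Option (Fin n)) (i s : Fin n) :
    Option (Fin n → Option (Fin n)) :=
  (firstFree occ s).map fun k => Function.update occ k (some i)

/-- One step of the MVP parking process: car `i` parks in its preferred spot
`s`; if `s` was occupied by an earlier car `j`, then `j` is bumped out and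
drives on to the first free spot `k ≥ s` (failure if none exists). -/
def mvpStep (occ : Fin n → Option (Fin n)) (i s : Fin n) :
    Option (Fin n → Option (Fin n)) :=
  match occ s with
  | none => some (Function.update occ s (some i))
  | some j =>
      (firstFree (Function.update occ s (some i)) s).map fun k =>
        Function.update (Function.update occ s (some i)) k (some j)

/-- Run a parking process: cars `0, 1, …, n-1` enter in order, with car `i`
preferring spot `p i`. Returns the final occupancy, or `none` on failure. -/
def runProcess
    (step : (Fin n → Option (Fin n)) → Fin n → Fin n → Option (Fin n → Option (Fin n)))
    (p : Fin n → Fin n) : Option (Fin n → Option (Fin n)) :=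
  List.foldlM (fun occ i => step occ i (p i)) (fun _ => none) (List.finRange n)

def mvpRun (p : Fin n → Fin n) : Option (Fin n → Option (Fin n)) :=
  runProcess mvpStep p

def classicalRun (p : Fin n → Fin n) : Option (Fin n → Option (Fin n)) :=
  runProcess classicalStep p

/-- All cars park successfully under the MVP process. -/
def IsMVPParking (p : Fin n → Fin n) : Prop := (mvpRun p).isSome

/-- All cars park successfully under the classical process. -/
def IsClassicalParking (p : Fin n → Fin n) : Prop := (classicalRun p).isSome

/-- `MVPOutcome p π` means that the MVP parking process for `p` succeeds, and
car `π i` finally occupies spot `i` for all `i`; that is, `O_MVP(p) = π`. -/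
def MVPOutcome (p : Fin n → Fin n) (π : Equiv.Perm (Fin n)) : Prop :=
  ∃ occ, mvpRun p = some occ ∧ ∀ i, occ i = some (π i)

/-- `p` is a parking function: for every `k`, at least `k+1` cars prefer a spot
`≤ k` (the classical counting characterisation, 0-indexed). -/
def IsParkingFunction (p : Fin n → Fin n) : Prop :=
  ∀ k : Fin n, (k : ℕ) + 1 ≤ (univ.filter fun i => p i ≤ k).card

/-- The fibre of the MVP outcome map over `π`: parking functions with MVP
outcome `π`. -/
def FibMVP (π : Equiv.Perm (Fin n)) : Set (Fin n → Fin n) :=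
  {p | IsParkingFunction p ∧ MVPOutcome p π}

/-- The set of inversions of `π` (where `π i` is the car occupying spot `i`):
pairs `(j, i)` with `j < i` and `π j > π i`. These are the edges of the
inversion graph `G_π`. -/
def invFinset (π : Equiv.Perm (Fin n)) : Finset (Fin n × Fin n) :=
  univ.filter fun e => e.1 < e.2 ∧ π e.2 < π e.1

/-- The left-inversions of `π` at `i`. -/
def lInv (π : Equiv.Perm (Fin n)) (i : Fin n) : Finset (Fin n) :=
  univ.filter fun j => j < i ∧ π i < π j

/-- A 1-subgraph of the inversion graph of `π`: a set of inversions with at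
most one incident left-arc at each vertex. -/
def IsOneSubgraph (π : Equiv.Perm (Fin n)) (S : Finset (Fin n × Fin n)) : Prop :=
  S ⊆ invFinset π ∧ ∀ i j j' : Fin n, (j, i) ∈ S → (j', i) ∈ S → j = j'

/-- The map `Ψ_{Sub→PF}`: the parking preference `p` where `p (π i) = j` if
`(j, i) ∈ S` (for the unique such `j`), and `p (π i) = i` otherwise. -/
noncomputable def subToPF (π : Equiv.Perm (Fin n)) (S : Finset (Fin n × Fin n)) :
    Fin n → Fin n := fun c =>
  if h : ∃ j, (j, π.symm c) ∈ S then h.choose else π.symm c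

/-- The map `Ψ_{PF→Sub}`: the set of inversions `(j, i)` of `π` with
`p (π i) = j`. -/
def pfToSub (π : Equiv.Perm (Fin n)) (p : Fin n → Fin n) : Finset (Fin n × Fin n) :=
  (invFinset π).filter fun e => p (π e.2) = e.1

/-- A 1-subgraph `S` is valid if the MVP outcome of `Ψ_{Sub→PF}(S)` is `π`. -/
def IsValid (π : Equiv.Perm (Fin n)) (S : Finset (Fin n × Fin n)) : Prop :=
  MVPOutcome (subToPF π S) π

/-- `π` contains the pattern `321`. -/
def Contains321 (π : Equiv.Perm (Fin n)) : Prop :=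
  ∃ i j k : Fin n, i < j ∧ j < k ∧ π k < π j ∧ π j < π i

/-- `π` contains the pattern `3412`. -/
def Contains3412 (π : Equiv.Perm (Fin n)) : Prop :=
  ∃ i j k l : Fin n, i < j ∧ j < k ∧ k < l ∧ π k < π l ∧ π l < π i ∧ π i < π j

/-- `S` is `P⃗₂`-free: there is no triple `i < j < k` with `(i,j) ∈ S` and
`(j,k) ∈ S`. -/
def P2Free (S : Finset (Fin n × Fin n)) : Prop :=
  ¬∃ i j k : Fin n, i < j ∧ j < k ∧ (i, j) ∈ S ∧ (j, k) ∈ S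

/-- `S` is horizontally separated (HS): any two distinct edges `(j,i)` and
`(j',i')` of `S` satisfy `i < j'` or `i' < j`. -/
def IsHS (S : Finset (Fin n × Fin n)) : Prop :=
  ∀ e ∈ S, ∀ e' ∈ S, e ≠ e' → e.2 < e'.1 ∨ e'.2 < e.1

/-- Steps of a Motzkin path: up, horizontal, down. -/
inductive MStep : Type
  | U : MStep
  | H : MStep
  | D : MStep
  deriving DecidableEq

/-- The height change of a step. -/
def stepVal : MStep → ℤ
  | MStep.U => 1
  | MStep.H => 0
  | MStep.D => -1

/-- The number of cars preferring spot `j` in `p`. -/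
def prefCount (p : Fin n → Fin n) (j : Fin n) : ℕ :=
  (univ.filter fun i => p i = j).card

/-- The lattice path `Φ(p)`: step `j` is `U`, `H` or `D` according to whether
spot `j` is preferred by at least two, exactly one, or no cars. -/
def Phi (p : Fin n → Fin n) : Fin n → MStep := fun j =>
  if 2 ≤ prefCount p j then MStep.U
  else if prefCount p j = 1 then MStep.H
  else MStep.D

/-- An `n`-step lattice path is a Motzkin path: it ends at height `0` and no
prefix goes below height `0`. -/
def IsMotzkinPath (φ : Fin n → MStep) : Prop :=
  (∑ j : Fin n, stepVal (φ j)) = 0 ∧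
  ∀ k : Fin n, 0 ≤ ∑ j ∈ univ.filter (fun j : Fin n => j ≤ k), stepVal (φ j)

/-- The decreasing permutation `dec_n = n(n-1)⋯1`: spot `i` gets car `n-1-i`
(0-indexed). -/
def decPerm (n : ℕ) : Equiv.Perm (Fin n) :=
  ⟨Fin.rev, Fin.rev, Fin.rev_rev, Fin.rev_rev⟩

/-- A non-crossing matching arc diagram on `{0, …, n-1}`: arcs go left to
right, each vertex is incident to at most one arc, and no two arcs cross. -/
def IsNonCrossMatching (S : Finset (Fin n × Fin n)) : Prop :=
  (∀ e ∈ S, e.1 < e.2) ∧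
  (∀ e ∈ S, ∀ e' ∈ S, e ≠ e' →
    e.1 ≠ e'.1 ∧ e.1 ≠ e'.2 ∧ e.2 ≠ e'.1 ∧ e.2 ≠ e'.2) ∧
  ¬∃ i j k l : Fin n, i < j ∧ j < k ∧ k < l ∧ (i, k) ∈ S ∧ (j, l) ∈ S

/-- A stable configuration `c` (grain counts, each `< n`) on the complete graph
`K_n` is recurrent; by Dhar's burning criterion this amounts on `K_n` to the
existence of an ordering `v` of the vertices with `c (v k) ≥ n - (k+1)` for
every `k` (0-indexed). -/
def IsRecurrentK (c : Fin n → ℕ) : Prop :=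
  (∀ i, c i < n) ∧ ∃ v : Equiv.Perm (Fin n), ∀ k : Fin n, n ≤ c (v k) + (k : ℕ) + 1

theorem firstFree_eq (occ : Fin n → Option (Fin n)) (s k : Fin n) (h1 : s ≤ k)
    (h2 : occ k = none) (h3 : ∀ i, s ≤ i → i < k → occ i ≠ none) :
    firstFree occ s = some k := by
  unfold firstFree
  rw [List.find?_eq_some_iff_getElem]
  refine ⟨by simp [h1, h2], k, by simp, by simp, ?_⟩
  intro i hi
  have hin : i < n := by omega
  by_cases hs : s ≤ (⟨i, hin⟩ : Fin n)
  · have := h3 ⟨i, hin⟩ hs hi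
    cases h : occ ⟨i, hin⟩ <;> simp_all
  · simp [hs]

theorem mvpStep_eq (occ occ' : Fin n → Option (Fin n)) (c s k j : Fin n) (h0 : occ s = some j)
    (h1 : s < k) (h2 : occ k = none) (h3 : ∀ i, s ≤ i → i < k → occ i ≠ none)
    (h4 : ∀ i, occ' i = if i = k then some j else if i = s then some c else occ i) :
    mvpStep occ c s = some occ' := by
  have hf : firstFree (Function.update occ s (some c)) s = some k := by
    apply firstFree_eq _ _ _ h1.le
    · rw [Function.update_of_ne h1.ne']; exact h2
    · intro i hi hk
      by_cases h : i = s
      · subst h; simp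
      · rw [Function.update_of_ne h]; exact h3 i hi hk
  unfold mvpStep
  rw [h0]
  simp only [hf, Option.map_some, Option.some.injEq]
  funext i
  rw [h4]
  simp only [Function.update_apply]

/-- The occupancy after cars `0, …, k+1` have parked. -/
def stAt (m a k : ℕ) : Fin (m + 2) → Option (Fin (m + 2)) := fun i =>
  if h : (i : ℕ) < k ∧ (i : ℕ) < m then some ⟨i + 2, by omega⟩
  else if k < a then
    (if (i : ℕ) = k then some ⟨1, by omega⟩ else if (i : ℕ) = a then some ⟨0, by omega⟩ else none)
  else if (i : ℕ) = k then some ⟨(k - a) % 2, by omega⟩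
  else if (i : ℕ) = k + 1 then some ⟨(k - a + 1) % 2, by omega⟩ else none

theorem stAt_step (m a k : ℕ) (hk : k < m) (ha : a < m) :
    mvpStep (stAt m a k) ⟨k + 2, by omega⟩ ⟨k, by omega⟩ = some (stAt m a (k + 1)) := by
  by_cases h1 : k + 1 < a
  · apply mvpStep_eq _ _ _ _ ⟨k + 1, by omega⟩ ⟨1, by omega⟩
    · simp [stAt]; omega
    · simp
    · simp only [stAt]
      split_ifs <;> first | rfl | omega | simp_all
    · rintro ⟨i, hi⟩ h2 h3
      simp at h2 h3
      obtain rfl : i = k := by omega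
      simp only [stAt]
      split_ifs <;> first | rfl | omega | simp_all
    · rintro ⟨i, hi⟩
      simp only [stAt, Fin.mk.injEq]
      split_ifs <;> first | rfl | omega | (simp; omega)
  · apply mvpStep_eq _ _ _ _ ⟨k + 2, by omega⟩
        (if k < a then ⟨1, by omega⟩ else ⟨(k - a) % 2, by omega⟩)
    · simp only [stAt]
      split_ifs <;> first | rfl | omega | simp_all
    · simp
    · simp only [stAt]
      split_ifs <;> first | rfl | omega | simp_all
    · rintro ⟨i, hi⟩ h2 h3
      simp at h2 h3
      simp only [stAt]
      split_ifs <;> first | omega | simp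
    · rintro ⟨i, hi⟩
      simp only [stAt, Fin.mk.injEq]
      split_ifs <;> first | rfl | omega | (simp; omega)

theorem run_take (m a : ℕ) (ha0 : 1 ≤ a) (ha : a < m) (p : Fin (m + 2) → Fin (m + 2))
    (p0 : p ⟨0, by omega⟩ = ⟨a, by omega⟩) (p1 : p ⟨1, by omega⟩ = ⟨0, by omega⟩)
    (p2 : ∀ k (hk : k < m), p ⟨k + 2, by omega⟩ = ⟨k, by omega⟩) (k : ℕ) (hk : k ≤ m) :
    List.foldlM (fun occ i => mvpStep occ i (p i)) (fun _ => none)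
      ((List.finRange (m + 2)).take (k + 2)) = some (stAt m a k) := by
  induction k with
  | zero =>
    have : (List.finRange (m + 2)).take 2 = [⟨0, by omega⟩, ⟨1, by omega⟩] := by
      apply List.ext_getElem
      · simp
      · intro i h1 h2
        simp at h2
        interval_cases i <;> simp
    rw [this]
    simp only [List.foldlM_cons, List.foldlM_nil, p0, p1]
    have e1 : mvpStep (fun _ => none) (⟨0, by omega⟩ : Fin (m+2)) ⟨a, by omega⟩ =
      some (Function.update (fun _ => none) ⟨a, by omega⟩ (some ⟨0, by omega⟩)) := rfl
    rw [e1]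
    simp only [Option.bind_eq_bind, Option.bind_some]
    have e2 : (Function.update (fun _ => none) ⟨a, by omega⟩ (some ⟨0, by omega⟩) :
      Fin (m+2) → Option (Fin (m+2))) ⟨0, by omega⟩ = none := by
      rw [Function.update_of_ne]
      simp; omega
    unfold mvpStep
    rw [e2]
    simp only [Option.bind_some]
    show some _ = some _
    congr 1
    funext ⟨i, hi⟩
    simp only [stAt, Function.update_apply, Fin.mk.injEq]
    split_ifs <;> first | rfl | omega
  | succ k ih =>
    have : (List.finRange (m + 2)).take (k + 1 + 2) =
        (List.finRange (m + 2)).take (k + 2) ++ [⟨k + 2, by omega⟩] := by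
      rw [show k + 1 + 2 = (k + 2) + 1 by omega, List.take_succ_eq_append_getElem (by simp; omega)]
      simp
    rw [this, List.foldlM_append, ih (by omega)]
    simp only [Option.bind_eq_bind, Option.bind_some, List.foldlM_cons, List.foldlM_nil, p2 k hk,
      stAt_step m a k hk ha]
    rfl

theorem subToPF_mem (π : Equiv.Perm (Fin n)) (S : Finset (Fin n × Fin n)) (c i j : Fin n)
    (hc : π i = c) (h : (j, i) ∈ S) (hu : ∀ j', (j', i) ∈ S → j' = j) : subToPF π S c = j := by
  subst hc
  unfold subToPF
  have hex : ∃ j, (j, π.symm (π i)) ∈ S := ⟨j, by simpa using h⟩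
  rw [dif_pos hex]
  apply hu
  simpa using hex.choose_spec

theorem subToPF_not_mem (π : Equiv.Perm (Fin n)) (S : Finset (Fin n × Fin n)) (c i : Fin n)
    (hc : π i = c) (hu : ∀ j', (j', i) ∉ S) : subToPF π S c = i := by
  subst hc
  unfold subToPF
  rw [dif_neg]
  · simp
  · simpa using hu

/-- for `2 ≤ j ≤ m` (1-indexed), the 1-subgraph of the inversion
graph of `τ_{m,2}` with the two crossing edges `(1, m+2)` and `(j, m+1)`
(0-indexed: `(0, m+1)` and `(j-1, m)`) is valid iff `m + j` is odd. -/
theorem statement15 (m j : ℕ) (hm : 1 ≤ m) (hj1 : 2 ≤ j) (hj2 : j ≤ m)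
    (π : Equiv.Perm (Fin (m + 2)))
    (hπ : ∀ i : Fin (m + 2),
      (π i : ℕ) = if (i : ℕ) < m then (i : ℕ) + 2 else (i : ℕ) - m) :
    (IsValid π
      ({((⟨0, by omega⟩ : Fin (m + 2)), (⟨m + 1, by omega⟩ : Fin (m + 2))),
        ((⟨j - 1, by omega⟩ : Fin (m + 2)), (⟨m, by omega⟩ : Fin (m + 2)))} :
        Finset (Fin (m + 2) × Fin (m + 2))) ↔ Odd (m + j)) := by
  have hrun : mvpRun (subToPF π
      ({((⟨0, by omega⟩ : Fin (m + 2)), (⟨m + 1, by omega⟩ : Fin (m + 2))),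
        ((⟨j - 1, by omega⟩ : Fin (m + 2)), (⟨m, by omega⟩ : Fin (m + 2)))} :
        Finset (Fin (m + 2) × Fin (m + 2)))) = some (stAt m (j - 1) m) := by
    unfold mvpRun runProcess
    rw [← run_take m (j - 1) (by omega) (by omega) _ ?_ ?_ ?_ m le_rfl]
    · rw [List.take_of_length_le (by simp)]
    · apply subToPF_mem _ _ _ ⟨m, by omega⟩
      · ext; rw [hπ]; simp
      · simp
      · intro j' h; simpa using h
    · apply subToPF_mem _ _ _ ⟨m + 1, by omega⟩
      · ext; rw [hπ]; simp
      · simp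
      · intro j' h; simpa using h
    · intro k hk
      apply subToPF_not_mem
      · ext; rw [hπ]; simp [hk]
      · intro j' h
        simp at h
        omega
  unfold IsValid MVPOutcome
  rw [hrun]
  constructor
  · rintro ⟨occ, h1, h2⟩
    obtain rfl := Option.some.inj h1
    have h3 := h2 ⟨m, by omega⟩
    have h4 := hπ ⟨m, by omega⟩
    simp only [stAt] at h3
    rw [dif_neg (by simp), if_neg (by omega), if_pos trivial, Option.some.injEq, Fin.ext_iff, h4] at h3
    simp at h3
    rw [Nat.odd_iff]
    omega
  · intro h
    rw [Nat.odd_iff] at h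
    refine ⟨_, rfl, ?_⟩
    rintro ⟨i, hi⟩
    have h4 := hπ ⟨i, hi⟩
    simp only at h4
    simp only [stAt]
    split_ifs <;> first | omega | (rw [Option.some.injEq, Fin.ext_iff, h4]; simp only; split_ifs <;> omega)

end MVPPaper
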